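/- arXiv:math/0006181 — 3 statements merged into one kernel-verified Lean document; each statement's English description precedes it below -/
import Mathlib

section
/- Let H be a finite abelian group (written additively) and b : H × H → ℚ/ℤ a nondegenerate symmetric biadditive form. Then there exists a quadratic form q : H → ℚ/ℤ (i.e., q(0) = 0, q(k • u) = k² • q(u) for all u ∈ H and k ∈ ℤ, and (u, v) ↦ q(u + v) − q(u) − q(v) is biadditive) whose associated bilinear form equals b: q(u + v) − q(u) − q(v) = b(u, v) for all u, v ∈ H. -/
/-- The underlying set `H × A` of the extension of `H` by `A` whose cocycle is the
biadditive map `b`. -/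
@[ext]
structure BiadditiveExtension {H A : Type*} [AddCommGroup H] [AddCommGroup A]
    (b : H →+ H →+ A) where
  base : H
  fibre : A

namespace BiadditiveExtension

variable {H A : Type*} [AddCommGroup H] [AddCommGroup A] {b : H →+ H →+ A}

instance : Add (BiadditiveExtension b) :=
  ⟨fun x y => ⟨x.base + y.base, x.fibre + y.fibre + b x.base y.base⟩⟩

instance : Zero (BiadditiveExtension b) := ⟨⟨0, 0⟩⟩

instance : Neg (BiadditiveExtension b) :=
  ⟨fun x => ⟨-x.base, -x.fibre + b x.base x.base⟩⟩

@[simp] lemma base_add (x y : BiadditiveExtension b) : (x + y).base = x.base + y.base := rfl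

@[simp] lemma fibre_add (x y : BiadditiveExtension b) :
    (x + y).fibre = x.fibre + y.fibre + b x.base y.base := rfl

@[simp] lemma base_zero : (0 : BiadditiveExtension b).base = 0 := rfl

@[simp] lemma fibre_zero : (0 : BiadditiveExtension b).fibre = 0 := rfl

@[simp] lemma base_neg (x : BiadditiveExtension b) : (-x).base = -x.base := rfl

@[simp] lemma fibre_neg (x : BiadditiveExtension b) :
    (-x).fibre = -x.fibre + b x.base x.base := rfl

/-- A symmetric biadditive map is a symmetric cocycle, so the extension is abelian. -/
@[reducible]
def addCommGroup (hb : ∀ u v, b u v = b v u) : AddCommGroup (BiadditiveExtension b) where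
  add_assoc x y z := by
    ext
    · simp [add_assoc]
    · simp only [fibre_add, base_add, map_add, AddMonoidHom.add_apply]
      abel
  zero_add x := by ext <;> simp
  add_zero x := by ext <;> simp
  neg_add_cancel x := by ext <;> simp
  add_comm x y := by
    ext
    · simp [add_comm]
    · simp [hb x.base y.base, add_comm]
  nsmul := nsmulRec
  zsmul := zsmulRec

end BiadditiveExtension

/-- Homomorphisms into `ℚ/ℤ` extend along injective homomorphisms. -/
lemma AddMonoidHom.exists_comp_eq_of_injective {A B : Type*} [AddCommGroup A] [AddCommGroup B]
    (i : A →+ B) (hi : Function.Injective i) (f : A →+ AddCircle (1 : ℚ)) :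
    ∃ g : B →+ AddCircle (1 : ℚ), ∀ a, g (i a) = f a := by
  obtain ⟨g, hg⟩ := CharacterModule.dual_surjective_of_injective i.toIntLinearMap hi f
  exact ⟨g, fun a => DFunLike.congr_fun hg a⟩

/-- A symmetric biadditive map into `ℚ/ℤ` is the coboundary of a function. -/
lemma exists_add_eq_of_symmetric {H : Type*} [AddCommGroup H]
    (b : H →+ H →+ AddCircle (1 : ℚ)) (hb : ∀ u v, b u v = b v u) :
    ∃ f : H → AddCircle (1 : ℚ), ∀ u v, f (u + v) = f u + f v + b u v := by
  let _ := BiadditiveExtension.addCommGroup hb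
  let i : AddCircle (1 : ℚ) →+ BiadditiveExtension b :=
    { toFun := fun a => ⟨0, a⟩
      map_zero' := rfl
      map_add' := fun x y => by ext <;> simp }
  have hi : Function.Injective i := fun x y h => congrArg BiadditiveExtension.fibre h
  obtain ⟨r, hr⟩ := i.exists_comp_eq_of_injective hi (AddMonoidHom.id _)
  refine ⟨fun u => -r ⟨u, 0⟩, fun u v => ?_⟩
  have h : (⟨u, 0⟩ + ⟨v, 0⟩ : BiadditiveExtension b) = ⟨u + v, 0⟩ + i (b u v) := by
    ext <;> simp [i]
  have h' := congrArg r h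
  rw [map_add, map_add, hr, AddMonoidHom.id_apply] at h'
  beta_reduce
  rw [← sub_eq_iff_eq_add.mpr h']
  abel

/-- A homomorphism into `ℚ/ℤ` killing the elements of order two factors through doubling. -/
lemma AddMonoidHom.exists_comp_two_nsmul_eq {H : Type*} [AddCommGroup H]
    (l : H →+ AddCircle (1 : ℚ)) (hl : ∀ u, u + u = 0 → l u = 0) :
    ∃ m : H →+ AddCircle (1 : ℚ), ∀ u, m u + m u = l u := by
  let d : H →+ H := AddMonoidHom.id H + AddMonoidHom.id H
  obtain ⟨m, hm⟩ := (QuotientAddGroup.kerLift d).exists_comp_eq_of_injective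
    (QuotientAddGroup.kerLift_injective d) (QuotientAddGroup.lift d.ker l fun u hu => hl u hu)
  exact ⟨m, fun u => by rw [← map_add]; exact hm u⟩

/-- An even function with biadditive polarization `b` scales quadratically. -/
lemma map_zsmul_of_even {H A : Type*} [AddCommGroup H] [AddCommGroup A]
    (b : H →+ H →+ A) (q : H → A) (hq : ∀ u v, q (u + v) = q u + q v + b u v)
    (heven : ∀ u, q (-u) = q u) (u : H) (k : ℤ) : q (k • u) = (k ^ 2 : ℤ) • q u := by
  have h0 : q 0 = 0 := by simpa using hq 0 0
  have hb : b u u = (2 : ℤ) • q u := by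
    have h := hq u (-u)
    rw [add_neg_cancel, h0, heven, map_neg, eq_comm, ← sub_eq_add_neg, sub_eq_zero] at h
    rw [← h, two_zsmul]
  have hsucc (k : ℤ) : q ((k + 1) • u) = q (k • u) + (2 * k + 1) • q u := by
    rw [add_zsmul, one_zsmul, hq, map_zsmul, AddMonoidHom.zsmul_apply, hb]
    module
  induction k with
  | zero => simpa using h0
  | succ n ih =>
    rw [hsucc, ih]
    module
  | pred n ih =>
    have h := hsucc (-n - 1)
    rw [sub_add_cancel, ih] at h
    rw [← sub_eq_iff_eq_add.mpr h]
    module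

/-- A symmetric biadditive map into `ℚ/ℤ` is the polarization of an even function. -/
lemma exists_even_add_eq_of_symmetric {H : Type*} [AddCommGroup H]
    (b : H →+ H →+ AddCircle (1 : ℚ)) (hb : ∀ u v, b u v = b v u) :
    ∃ q : H → AddCircle (1 : ℚ),
      (∀ u v, q (u + v) = q u + q v + b u v) ∧ ∀ u, q (-u) = q u := by
  obtain ⟨f, hf⟩ := exists_add_eq_of_symmetric b hb
  let l : H →+ AddCircle (1 : ℚ) := AddMonoidHom.mk' (fun u => f (-u) - f u) fun u v => by
    rw [neg_add, hf, hf, map_neg, map_neg, AddMonoidHom.neg_apply, neg_neg]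
    abel
  obtain ⟨m, hm⟩ := l.exists_comp_two_nsmul_eq fun u hu => by
    simp [l, neg_eq_of_add_eq_zero_left hu]
  refine ⟨fun u => f u + m u, fun u v => ?_, fun u => ?_⟩
  · beta_reduce
    rw [hf, map_add]
    abel
  · have h : m u + m u = f (-u) - f u := hm u
    beta_reduce
    rw [map_neg, sub_eq_iff_eq_add.mp h.symm]
    abel


/-- Every nondegenerate symmetric biadditive form `b` on a finite abelian
group `H` with values in `ℚ/ℤ` is the associated bilinear form of a quadratic form
`q : H → ℚ/ℤ`. -/
theorem stmt3 (H : Type*) [AddCommGroup H] [Fintype H]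
    (b : H → H → AddCircle (1 : ℚ))
    (hbil₁ : ∀ u u' v : H, b (u + u') v = b u v + b u' v)
    (hbil₂ : ∀ u v v' : H, b u (v + v') = b u v + b u v')
    (hsymm : ∀ u v : H, b u v = b v u)
    (hnd : ∀ g : H, (∀ h : H, b g h = 0) → g = 0) :
    ∃ q : H → AddCircle (1 : ℚ),
      q 0 = 0 ∧
      (∀ (u : H) (k : ℤ), q (k • u) = (k ^ 2 : ℤ) • q u) ∧
      (∀ u u' v : H, (q (u + u' + v) - q (u + u') - q v) =
        (q (u + v) - q u - q v) + (q (u' + v) - q u' - q v)) ∧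
      (∀ u v v' : H, (q (u + (v + v')) - q u - q (v + v')) =
        (q (u + v) - q u - q v) + (q (u + v') - q u - q v')) ∧
      (∀ u v : H, q (u + v) - q u - q v = b u v) := by
  let B : H →+ H →+ AddCircle (1 : ℚ) :=
    AddMonoidHom.mk' (fun u => AddMonoidHom.mk' (b u) (hbil₂ u)) fun u u' =>
      AddMonoidHom.ext (hbil₁ u u')
  obtain ⟨q, hq, heven⟩ := exists_even_add_eq_of_symmetric B hsymm
  have hpolar (u v : H) : q (u + v) - q u - q v = b u v := by
    rw [hq, add_assoc, add_sub_cancel_left, add_sub_cancel_left]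
    rfl
  refine ⟨q, by simpa using hq 0 0, map_zsmul_of_even B q hq heven, fun u u' v => ?_,
    fun u v v' => ?_, hpolar⟩
  · simp only [hpolar, hbil₁]
  · simp only [hpolar, hbil₂]
end

section
/- Let H be a finite abelian group (written additively), b : H × H → ℚ/ℤ a symmetric biadditive form, and q : H → ℚ/ℤ a quadratic form whose associated bilinear form satisfies q(u + v) − q(u) − q(v) = −b(u, v) for all u, v ∈ H. Then a function Ξ : H → ℚ/ℤ satisfies the second-order difference equation Ξ(g₁ + g₂ + h) − Ξ(g₁ + h) − Ξ(g₂ + h) + Ξ(h) = −b(g₁, g₂) for all g₁, g₂, h ∈ H if and only if there exist a constant c ∈ ℚ/ℤ and an additive group homomorphism λ : H → ℚ/ℤ such that Ξ(h) = c + λ(h) + q(h) for all h ∈ H. -/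
/-- With `b` symmetric biadditive and `q` a quadratic form satisfying
`q(u+v) - q(u) - q(v) = -b(u,v)`, a function `Ξ : H → ℚ/ℤ` satisfies
`Ξ(g₁+g₂+h) - Ξ(g₁+h) - Ξ(g₂+h) + Ξ(h) = -b(g₁,g₂)` for all `g₁,g₂,h` iff
`Ξ = c + λ + q` for some constant `c` and additive homomorphism `λ`. -/
theorem stmt7 (H : Type*) [AddCommGroup H] [Fintype H]
    (b : H → H → AddCircle (1 : ℚ))
    (hbil₁ : ∀ u u' v : H, b (u + u') v = b u v + b u' v)
    (hbil₂ : ∀ u v v' : H, b u (v + v') = b u v + b u v')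
    (hsymm : ∀ u v : H, b u v = b v u)
    (q : H → AddCircle (1 : ℚ))
    (hq0 : q 0 = 0)
    (hqk : ∀ (u : H) (k : ℤ), q (k • u) = (k ^ 2 : ℤ) • q u)
    (hqb : ∀ u v : H, q (u + v) - q u - q v = -b u v)
    (Ξ : H → AddCircle (1 : ℚ)) :
    (∀ g₁ g₂ h : H, Ξ (g₁ + g₂ + h) - Ξ (g₁ + h) - Ξ (g₂ + h) + Ξ h = -b g₁ g₂) ↔
      ∃ (c : AddCircle (1 : ℚ)) (lam : H →+ AddCircle (1 : ℚ)),
        ∀ h : H, Ξ h = c + lam h + q h := by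
  constructor
  · intro hΞ
    refine ⟨Ξ 0, AddMonoidHom.mk' (fun h ↦ Ξ h - Ξ 0 - q h) fun u v ↦ ?_, fun h ↦ ?_⟩
    · have h₁ := hΞ u v 0
      simp only [add_zero, ← hqb u v] at h₁
      rw [← sub_eq_zero] at h₁ ⊢
      rw [← h₁]
      abel
    · simp only [AddMonoidHom.mk'_apply]
      abel
  · rintro ⟨c, lam, hΞ⟩ g₁ g₂ h
    have h₁ := hqb g₁ (g₂ + h)
    have h₂ := hqb g₁ h
    rw [hbil₂, ← add_assoc, sub_sub, sub_eq_iff_eq_add] at h₁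
    rw [sub_sub, sub_eq_iff_eq_add] at h₂
    simp only [hΞ, map_add, h₁, h₂]
    abel
end

section
/- Let H be a finite abelian group (written additively), b : H × H → ℚ/ℤ a nondegenerate symmetric biadditive form, and q : H → ℚ/ℤ a quadratic form with q(u + v) − q(u) − q(v) = −b(u, v) for all u, v ∈ H. Suppose Ξ : H → ℚ/ℤ satisfies Ξ(g₁ + g₂ + h) − Ξ(g₁ + h) − Ξ(g₂ + h) + Ξ(h) = −b(g₁, g₂) for all g₁, g₂, h ∈ H. Then there exists a unique g ∈ H for which the translated function h ↦ Ξ(g + h) − q(h) is constant; equivalently, there exist a unique g ∈ H and a constant c ∈ ℚ/ℤ such that Ξ(g + h) = c + q(h) for all h ∈ H. -/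
/-- A faithful complex-valued character of `ℚ/ℤ`. -/
theorem exists_injective_addChar_ratAddCircle :
    ∃ ψ : AddChar (AddCircle (1 : ℚ)) ℂ, Function.Injective ψ := by
  let f : AddCircle (1 : ℚ) →+ AddCircle (1 : ℝ) :=
    QuotientAddGroup.map _ _ (Rat.castHom ℝ).toAddMonoidHom (by
      rintro _ ⟨n, rfl⟩
      exact ⟨n, by simp⟩)
  have hf : Function.Injective f := by
    rw [injective_iff_map_eq_zero]
    intro x hx
    obtain ⟨x, rfl⟩ := QuotientAddGroup.mk_surjective x
    obtain ⟨n, hn⟩ := (AddCircle.coe_eq_zero_iff (1 : ℝ)).mp hx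
    refine (AddCircle.coe_eq_zero_iff (1 : ℚ)).mpr ⟨n, ?_⟩
    simp only [zsmul_eq_mul, mul_one] at hn ⊢
    exact Rat.cast_injective (α := ℝ) (by simpa using hn)
  let χ : AddChar (AddCircle (1 : ℚ)) Circle :=
    AddChar.compAddMonoidHom AddCircle.toCircle_addChar f
  exact ⟨Circle.coeHom.compAddChar χ,
    Circle.coe_injective.comp ((AddCircle.injective_toCircle one_ne_zero).comp hf)⟩

/-- An injective homomorphism from a finite abelian group to its group of `ℚ/ℤ`-valued
characters is surjective. -/
theorem surjective_of_injective_ratAddCircle_dual {H : Type*} [AddCommGroup H] [Finite H]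
    (B : H →+ (H →+ AddCircle (1 : ℚ))) (hB : Function.Injective B) :
    Function.Surjective B := by
  have := Fintype.ofFinite H
  obtain ⟨ψ, hψ⟩ := exists_injective_addChar_ratAddCircle
  have hinj : Function.Injective fun f : H →+ AddCircle (1 : ℚ) ↦ ψ.compAddMonoidHom f :=
    AddChar.compAddMonoidHom_injective_right ψ hψ
  have hbij := (Fintype.bijective_iff_injective_and_card
    (fun g ↦ ψ.compAddMonoidHom (B g))).mpr ⟨hinj.comp hB, AddChar.card_eq.symm⟩
  intro f
  obtain ⟨g, hg⟩ := hbij.2 (ψ.compAddMonoidHom f)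
  exact ⟨g, hinj hg⟩


/-- With `b` a nondegenerate symmetric biadditive form and `q` a quadratic
form with `q(u+v) - q(u) - q(v) = -b(u,v)`, any solution `Ξ` of
`Ξ(g₁+g₂+h) - Ξ(g₁+h) - Ξ(g₂+h) + Ξ(h) = -b(g₁,g₂)` admits a unique `g ∈ H` such that
`h ↦ Ξ(g+h) - q(h)` is constant, i.e. a unique `g` with `Ξ(g+h) = c + q(h)` for some
constant `c`. -/
theorem stmt8 (H : Type*) [AddCommGroup H] [Fintype H]
    (b : H → H → AddCircle (1 : ℚ))
    (hbil₁ : ∀ u u' v : H, b (u + u') v = b u v + b u' v)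
    (hbil₂ : ∀ u v v' : H, b u (v + v') = b u v + b u v')
    (hsymm : ∀ u v : H, b u v = b v u)
    (hnd : ∀ g : H, (∀ h : H, b g h = 0) → g = 0)
    (q : H → AddCircle (1 : ℚ))
    (hq0 : q 0 = 0)
    (hqk : ∀ (u : H) (k : ℤ), q (k • u) = (k ^ 2 : ℤ) • q u)
    (hqb : ∀ u v : H, q (u + v) - q u - q v = -b u v)
    (Ξ : H → AddCircle (1 : ℚ))
    (hΞ : ∀ g₁ g₂ h : H, Ξ (g₁ + g₂ + h) - Ξ (g₁ + h) - Ξ (g₂ + h) + Ξ h = -b g₁ g₂) :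
    ∃! g : H, ∃ c : AddCircle (1 : ℚ), ∀ h : H, Ξ (g + h) = c + q h := by
  let B : H →+ (H →+ AddCircle (1 : ℚ)) :=
    AddMonoidHom.mk' (fun g ↦ AddMonoidHom.mk' (b g) (hbil₂ g)) fun u u' ↦
      AddMonoidHom.ext (hbil₁ u u')
  have hB : Function.Injective B := (injective_iff_map_eq_zero B).mpr fun g hg ↦
    hnd g fun h ↦ DFunLike.congr_fun hg h
  let l : H →+ AddCircle (1 : ℚ) := AddMonoidHom.mk' (fun h ↦ Ξ h - Ξ 0 - q h) fun u v ↦ by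
    have h₁ := hΞ u v 0
    rw [← hqb u v] at h₁
    simp only [add_zero] at h₁
    rw [← sub_eq_zero] at h₁ ⊢
    rw [← h₁]
    abel
  obtain ⟨g, hg⟩ := surjective_of_injective_ratAddCircle_dual B hB l
  have hl (h : H) : Ξ h = Ξ 0 + q h + b g h := by
    have : b g h = Ξ h - Ξ 0 - q h := DFunLike.congr_fun hg h
    rw [this]
    abel
  have hq (u v : H) : q (u + v) = q u + q v - b u v := by
    rw [sub_eq_add_neg, ← hqb]
    abel
  refine ⟨g, ⟨Ξ 0 + q g + b g g, fun h ↦ ?_⟩, ?_⟩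
  · rw [hl, hq, hbil₂]
    abel
  · rintro g' ⟨c, hc⟩
    have key (h : H) : Ξ 0 + q g' + b g g' + b g h - b g' h = c := by
      have := hc h
      rw [hl, hq, hbil₂] at this
      rw [← add_right_cancel_iff (a := q h), ← this]
      abel
    have hb0 (u : H) : b u 0 = 0 := map_zero (B u)
    refine hB (AddMonoidHom.ext fun h ↦ ?_)
    change b g' h = b g h
    have h₁ := (key h).trans (key 0).symm
    rw [hb0, hb0, add_zero, sub_zero, add_sub_assoc, add_eq_left, sub_eq_zero] at h₁
    exact h₁.symm
end
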